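/- The interface simulation distance for the limit-average objective is reflexive: for every BIA F, every output error model MO, and every input error model MI, d^{LimAvg}(F⊗MO, F⊗MI) = 0. -/

import Mathlib

open scoped Classical

/-! ### Game graphs, strategies, plays, objectives -/

/-- A two-player game graph: a set of states partitioned into Player-1 states `S1`
and Player-2 states `S2`, an edge relation `E` in which every state has at least one
outgoing edge, and an initial state `init`. -/
structure GameGraph (S : Type) where
  S1 : Set S
  S2 : Set S
  partition : ∀ s, s ∈ S1 ↔ s ∉ S2
  E : S → S → Prop
  init : S
  serial : ∀ s, ∃ t, E s t

/-- A strategy for the player owning the states in `P`: given the history `w` and the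
current state `s ∈ P`, it chooses a successor along an edge. -/
structure Strat {S : Type} (H : GameGraph S) (P : Set S) where
  f : List S → S → S
  valid : ∀ w s, s ∈ P → H.E s (f w s)

/-- A strategy is memoryless (positional) if its choice does not depend on the history. -/
def Strat.Memoryless {S : Type} {H : GameGraph S} {P : Set S} (π : Strat H P) : Prop :=
  ∀ w w' s, π.f w s = π.f w' s

/-- Auxiliary: the pair (history, current state) after `n` steps when Player 1 plays `π1`
and Player 2 plays `π2`. -/
noncomputable def GameGraph.hist {S : Type} (H : GameGraph S)
    (π1 : Strat H H.S1) (π2 : Strat H H.S2) : ℕ → List S × S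
  | 0 => ([], H.init)
  | n + 1 =>
      let p := GameGraph.hist H π1 π2 n
      (p.1 ++ [p.2], if p.2 ∈ H.S1 then π1.f p.1 p.2 else π2.f p.1 p.2)

/-- The unique play `Out_H(π1, π2)` conformant to both strategies. -/
noncomputable def GameGraph.outcome {S : Type} (H : GameGraph S)
    (π1 : Strat H H.S1) (π2 : Strat H H.S2) : ℕ → S :=
  fun n => (H.hist π1 π2 n).2

/-- A play of the game graph: an infinite sequence of states starting at the initial state
and following edges. -/
def GameGraph.IsPlay {S : Type} (H : GameGraph S) (ρ : ℕ → S) : Prop :=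
  ρ 0 = H.init ∧ ∀ n, H.E (ρ n) (ρ (n + 1))

/-- A play `ρ` is conformant to a strategy `π` (of the player owning `P`) if at every
position in `P` the play follows the choice of `π`. -/
def Conformant {S : Type} {H : GameGraph S} {P : Set S} (π : Strat H P) (ρ : ℕ → S) : Prop :=
  ∀ n, ρ n ∈ P → ρ (n + 1) = π.f (List.ofFn fun i : Fin n => ρ i) (ρ n)

/-- The limit-average objective `LimAvg(ρ) = liminf (1/n)·Σ_{i<n} ω(ρ i, ρ (i+1))`. -/
noncomputable def limAvg {S : Type} (ω : S → S → ℤ) (ρ : ℕ → S) : ℝ :=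
  Filter.liminf
    (fun n : ℕ => (∑ i ∈ Finset.range n, (ω (ρ i) (ρ (i + 1)) : ℝ)) / (n : ℝ))
    Filter.atTop

/-- The discounted-sum objective `Disc_λ(ρ) = Σ_i λ^i · ω(ρ i, ρ (i+1))`. -/
noncomputable def disc {S : Type} (lam : ℝ) (ω : S → S → ℤ) (ρ : ℕ → S) : ℝ :=
  ∑' i : ℕ, lam ^ i * (ω (ρ i) (ρ (i + 1)) : ℝ)

/-- The lower value `sup_{π1} inf_{π2} f(Out(π1,π2))` of the game (in `EReal`). -/
noncomputable def GameGraph.supInf {S : Type} (H : GameGraph S) (f : (ℕ → S) → ℝ) : EReal :=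
  ⨆ π1 : Strat H H.S1, ⨅ π2 : Strat H H.S2, ((f (H.outcome π1 π2) : ℝ) : EReal)

/-- The upper value `inf_{π2} sup_{π1} f(Out(π1,π2))` of the game (in `EReal`). -/
noncomputable def GameGraph.infSup {S : Type} (H : GameGraph S) (f : (ℕ → S) → ℝ) : EReal :=
  ⨅ π2 : Strat H H.S2, ⨆ π1 : Strat H H.S1, ((f (H.outcome π1 π2) : ℝ) : EReal)

/-! ### Interface automata -/

/-- An interface automaton (transition system with input and output actions).
Broadcast interface automata (BIAs) are those satisfying `IA.IsBIA`; systems modified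
by an error model are interface automata that need not be input-deterministic. -/
structure IA (Q : Type) (Act : Type) where
  init : Q
  AI : Set Act
  AO : Set Act
  delta : Q → Act → Q → Prop

namespace IA

/-- `F` is a broadcast interface automaton: inputs and outputs are disjoint, transitions
are labeled by actions, and `F` is input-deterministic. -/
structure IsBIA {Q Act : Type} (F : IA Q Act) : Prop where
  disj : Disjoint F.AI F.AO
  dom : ∀ q a q', F.delta q a q' → a ∈ F.AI ∪ F.AO
  inputDet : ∀ q a q' q'', a ∈ F.AI → F.delta q a q' → F.delta q a q'' → q' = q''

/-- The input actions enabled at state `q` (written `AI(q)`). -/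
def enabledI {Q Act : Type} (F : IA Q Act) (q : Q) : Set Act :=
  {a | a ∈ F.AI ∧ ∃ q', F.delta q a q'}

/-- The output actions enabled at state `q` (written `AO(q)`). -/
def enabledO {Q Act : Type} (F : IA Q Act) (q : Q) : Set Act :=
  {a | a ∈ F.AO ∧ ∃ q', F.delta q a q'}

/-- `R` is an alternating simulation by `F` of `F'`. -/
def AltSim {Q Q' Act : Type} (F : IA Q Act) (F' : IA Q' Act) (R : Q → Q' → Prop) : Prop :=
  ∀ q q', R q q' →
    (∀ a ∈ F.AI, ∀ r, F.delta q a r → ∃ r', F'.delta q' a r' ∧ R r r') ∧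
    (∀ a ∈ F'.AO, ∀ r', F'.delta q' a r' → ∃ r, F.delta q a r ∧ R r r')

/-- `F'` refines `F`, written `F ⪰ F'`. -/
def Refines {Q Q' Act : Type} (F : IA Q Act) (F' : IA Q' Act) : Prop :=
  F.AI ⊆ F'.AI ∧ F'.AO ⊆ F.AO ∧ ∃ R, AltSim F F' R ∧ R F.init F'.init

end IA

/-! ### Error models and modified systems -/

/-- An error model on the action set `D` (the inputs, resp. the outputs): a partial
cost function (`none` plays the role of `⊥` = infinity) which is reflexive with cost `0`
and satisfies the triangle inequality. -/
structure ErrorModel (Act : Type) (D : Set Act) where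
  M : Act → Act → Option ℕ
  dom : ∀ a b, M a b ≠ none → a ∈ D ∧ b ∈ D
  refl : ∀ a ∈ D, M a a = some 0
  triangle : ∀ a b c x y, M a b = some x → M b c = some y → ∃ z, z ≤ x + y ∧ M a c = some z

namespace IA

/-- The modified system `F ⊗ M`: transitions on actions outside the domain of the error
model are kept, and a transition `(s, σ₂, t)` is added whenever there is `(s, σ₁, t) ∈ δ`
with `M(σ₁, σ₂) ≠ ⊥`. -/
def modify {Q Act : Type} {D : Set Act} (F : IA Q Act) (M : ErrorModel Act D) : IA Q Act where
  init := F.init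
  AI := F.AI
  AO := F.AO
  delta := fun s b t => (b ∉ D ∧ F.delta s b t) ∨ ∃ a, F.delta s a t ∧ M.M a b ≠ none

/-- The weight function `ω_M` of the modified system `F ⊗ M`:
`ω_M(s, σ₂, t) = min { M(σ₁,σ₂) | (s,σ₁,t) ∈ δ }` (and `0` on unmodified transitions). -/
noncomputable def mweight {Q Act : Type} {D : Set Act} (F : IA Q Act) (M : ErrorModel Act D) :
    Q → Act → Q → ℕ :=
  fun s b t => sInf {n : ℕ | ∃ a, F.delta s a t ∧ M.M a b = some n}

/-! ### Composition -/

/-- The action alphabet of `F`. -/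
def acts {Q Act : Type} (F : IA Q Act) : Set Act := F.AI ∪ F.AO

/-- The shared actions of `F` and `G`. -/
def shared {Q R Act : Type} (F : IA Q Act) (G : IA R Act) : Set Act := F.acts ∩ G.acts

/-- `F` and `G` are composable: their inputs do not mix, nor do their outputs. -/
def Composable {Q R Act : Type} (F : IA Q Act) (G : IA R Act) : Prop :=
  Disjoint F.AI G.AI ∧ Disjoint F.AO G.AO

/-- The product automaton `F ⊗ G`. -/
def prod {Q R Act : Type} (F : IA Q Act) (G : IA R Act) : IA (Q × R) Act where
  init := (F.init, G.init)
  AI := (F.AI ∪ G.AI) \ shared F G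
  AO := F.AO ∪ G.AO
  delta := fun s σ t =>
    (σ ∉ shared F G ∧ F.delta s.1 σ t.1 ∧ s.2 = t.2) ∨
    (σ ∉ shared F G ∧ G.delta s.2 σ t.2 ∧ s.1 = t.1) ∨
    (σ ∈ shared F G ∧ F.delta s.1 σ t.1 ∧ G.delta s.2 σ t.2)

/-- A state `(p, q)` of the product `F ⊗ G` is an error state. -/
def errorState {Q R Act : Type} (F : IA Q Act) (G : IA R Act) (s : Q × R) : Prop :=
  ∃ σ ∈ shared F G,
    (σ ∈ F.enabledO s.1 ∧ σ ∉ G.enabledI s.2) ∨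
    (σ ∈ G.enabledO s.2 ∧ σ ∉ F.enabledI s.1)

/-- One step of the product using only output actions. -/
def outputStep {Q R Act : Type} (F : IA Q Act) (G : IA R Act) (s t : Q × R) : Prop :=
  ∃ σ ∈ (F.prod G).AO, (F.prod G).delta s σ t

/-- A product state is compatible if no error state is reachable from it using only
output actions. -/
def compatibleState {Q R Act : Type} (F : IA Q Act) (G : IA R Act) (s : Q × R) : Prop :=
  ∀ t, Relation.ReflTransGen (outputStep F G) s t → ¬ errorState F G t

/-- `F` and `G` are compatible (`F ∼ G`): the initial state of `F ⊗ G` is compatible. -/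
def Compatible {Q R Act : Type} (F : IA Q Act) (G : IA R Act) : Prop :=
  compatibleState F G (F.init, G.init)

/-- The composition `F ∥ G`: the product restricted by removing input-action transitions
leading from compatible to incompatible states. -/
def par {Q R Act : Type} (F : IA Q Act) (G : IA R Act) : IA (Q × R) Act where
  init := (F.init, G.init)
  AI := (F.prod G).AI
  AO := (F.prod G).AO
  delta := fun s σ t => (F.prod G).delta s σ t ∧
    ¬(σ ∈ (F.prod G).AI ∧ compatibleState F G s ∧ ¬ compatibleState F G t)

end IA

/-- The output error model `MO` is restricted with respect to `G` (for the component `F`):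
for `σ₁ ≠ σ₂`, if `MO(σ₁,σ₂) ≠ ⊥` then `σ₂ ∈ AO_{F∥G} \ AO_G`. -/
def OutRestricted {Q R Act : Type} {DO : Set Act} (MO : ErrorModel Act DO)
    (F : IA Q Act) (G : IA R Act) : Prop :=
  ∀ a b, a ≠ b → MO.M a b ≠ none → b ∈ (F.par G).AO \ G.AO

/-- The input error model `MI` is restricted with respect to `G` (for the component `F'`):
for `σ₁ ≠ σ₂`, if `MI(σ₁,σ₂) ≠ ⊥` then `σ₂ ∈ AI_{F'∥G} \ AI_G`. -/
def InRestricted {Q' R Act : Type} {DI : Set Act} (MI : ErrorModel Act DI)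
    (F' : IA Q' Act) (G : IA R Act) : Prop :=
  ∀ a b, a ≠ b → MI.M a b ≠ none → b ∈ (F'.par G).AI \ G.AI

/-! ### The alternating simulation game -/

/-- States of the alternating simulation game for automata `X` (states `Q`) and
`Y` (states `Q'`): the error state `err`, Player-1 states `st q none q'` (the `#` states)
and Player-2 states `st q (some σ) q'`. -/
inductive GS (Q Q' Act : Type)
  | err : GS Q Q' Act
  | st : Q → Option Act → Q' → GS Q Q' Act

/-- Player-2 states of the simulation game are those carrying an action to be matched. -/
def GS.isP2 {Q Q' Act : Type} : GS Q Q' Act → Prop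
  | .st _ (some _) _ => True
  | _ => False

/-- The primary edges of the alternating simulation game `H_{X,Y}`:
Player 1 chooses an input transition of `X` or an output transition of `Y`;
Player 2 matches by an input transition of `Y` or an output transition of `X`. -/
def rawEdge {Q Q' Act : Type} (X : IA Q Act) (Y : IA Q' Act) :
    GS Q Q' Act → GS Q Q' Act → Prop
  | .st s none s', .st t (some σ) t' =>
      (σ ∈ X.AI ∧ X.delta s σ t ∧ t' = s') ∨ (σ ∈ Y.AO ∧ Y.delta s' σ t' ∧ t = s)
  | .st s (some σ) s', .st t none t' =>
      (σ ∈ X.AI ∧ Y.delta s' σ t' ∧ t = s) ∨ (σ ∈ Y.AO ∧ X.delta s σ t ∧ t' = s')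
  | _, _ => False

/-- The alternating simulation game `H_{X,Y}`: its edges are the primary edges, plus an
edge to `err` from every stuck Player-2 state, and a self-loop on every stuck Player-1
state (in particular on `err`). -/
def simGame {Q Q' Act : Type} (X : IA Q Act) (Y : IA Q' Act) : GameGraph (GS Q Q' Act) where
  S1 := {s | ¬ s.isP2}
  S2 := {s | s.isP2}
  partition := fun _ => Iff.rfl
  E := fun x y => rawEdge X Y x y ∨
    (x.isP2 ∧ (∀ z, ¬ rawEdge X Y x z) ∧ y = GS.err) ∨
    (¬ x.isP2 ∧ (∀ z, ¬ rawEdge X Y x z) ∧ y = x)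
  init := GS.st X.init none Y.init
  serial := by
    intro s
    by_cases h : ∃ z, rawEdge X Y s z
    · obtain ⟨z, hz⟩ := h
      exact ⟨z, Or.inl hz⟩
    · push_neg at h
      by_cases h2 : s.isP2
      · exact ⟨GS.err, Or.inr (Or.inl ⟨h2, h, rfl⟩)⟩
      · exact ⟨s, Or.inr (Or.inr ⟨h2, h, rfl⟩)⟩

/-- The weights of the quantitative simulation game: edges leaving Player-1 states get
weight `0`, except around `err` where the weight is the maximal finite weight `W`; an edge
leaving a Player-2 state gets twice the weight of the matched transition (`wY` on the
matched input transition of `Y`, `wX` on the matched output transition of `X`). -/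
noncomputable def gameWeight {Q Q' Act : Type} (X : IA Q Act)
    (wX : Q → Act → Q → ℕ) (wY : Q' → Act → Q' → ℕ) (W : ℕ) :
    GS Q Q' Act → GS Q Q' Act → ℤ :=
  fun x y =>
    match x, y with
    | .err, _ => (W : ℤ)
    | _, .err => (W : ℤ)
    | .st s (some σ) s', .st t none t' =>
        if σ ∈ X.AI then 2 * (wY s' σ t' : ℤ) else 2 * (wX s σ t : ℤ)
    | _, _ => 0

/-- The maximal finite weight assigned by the two error models. -/
noncomputable def maxW {Act : Type} {DO DI : Set Act}
    (MO : ErrorModel Act DO) (MI : ErrorModel Act DI) : ℕ :=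
  sSup {n : ℕ | (∃ a b, MO.M a b = some n) ∨ (∃ a b, MI.M a b = some n)}

/-- The interface simulation distance `d^{LimAvg}(F ⊗ MO, F' ⊗ MI)`: the value of the
quantitative simulation game `H_{F⊗MO, F'⊗MI}` with the limit-average objective. -/
noncomputable def distLimAvg {Q Q' Act : Type} {DO DI : Set Act}
    (F : IA Q Act) (MO : ErrorModel Act DO) (F' : IA Q' Act) (MI : ErrorModel Act DI) :
    EReal :=
  (simGame (F.modify MO) (F'.modify MI)).supInf
    (limAvg (gameWeight (F.modify MO) (F.mweight MO) (F'.mweight MI) (maxW MO MI)))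

/-- The interface simulation distance `d^{Disc_λ}(F ⊗ MO, F' ⊗ MI)`: the value of the
quantitative simulation game `H_{F⊗MO, F'⊗MI}` with the discounted-sum objective. -/
noncomputable def distDisc {Q Q' Act : Type} {DO DI : Set Act} (lam : ℝ)
    (F : IA Q Act) (MO : ErrorModel Act DO) (F' : IA Q' Act) (MI : ErrorModel Act DI) :
    EReal :=
  (simGame (F.modify MO) (F'.modify MI)).supInf
    (disc lam (gameWeight (F.modify MO) (F.mweight MO) (F'.mweight MI) (maxW MO MI)))

/-! ### Abstractions -/

namespace IA

/-- The `∀∃` abstraction of `F` with respect to an equivalence relation on its states: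
input transitions are abstracted universally, output transitions existentially. -/
def absFE {Q Act : Type} (F : IA Q Act) (s : Setoid Q) : IA (Quotient s) Act where
  init := Quotient.mk s F.init
  AI := F.AI
  AO := F.AO
  delta := fun c σ c' =>
    (σ ∈ F.AI ∧ ∀ q, Quotient.mk s q = c → ∃ q', Quotient.mk s q' = c' ∧ F.delta q σ q') ∨
    (σ ∈ F.AO ∧ ∃ q q', Quotient.mk s q = c ∧ Quotient.mk s q' = c' ∧ F.delta q σ q')

/-- The `∃∀` abstraction of `F` with respect to an equivalence relation on its states:
input transitions are abstracted existentially, output transitions universally. -/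
def absEF {Q Act : Type} (F : IA Q Act) (s : Setoid Q) : IA (Quotient s) Act where
  init := Quotient.mk s F.init
  AI := F.AI
  AO := F.AO
  delta := fun c σ c' =>
    (σ ∈ F.AI ∧ ∃ q q', Quotient.mk s q = c ∧ Quotient.mk s q' = c' ∧ F.delta q σ q') ∨
    (σ ∈ F.AO ∧ ∀ q, Quotient.mk s q = c → ∃ q', Quotient.mk s q' = c' ∧ F.delta q σ q')

end IA

/-- Invariant of the copying strategy. -/
def CopyInv {Q Act : Type} (F : IA Q Act) (x : GS Q Q Act) : Prop :=
  (∃ q, x = .st q none q) ∨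
  (∃ q σ t, x = .st t (some σ) q ∧ σ ∈ F.AI ∧ F.delta q σ t) ∨
  (∃ q σ t, x = .st q (some σ) t ∧ σ ∈ F.AO ∧ F.delta q σ t)

/-- Target of the copying strategy. -/
noncomputable def copyTarget {Q Act : Type} (F : IA Q Act) : GS Q Q Act → GS Q Q Act
  | .st s (some σ) s' => if σ ∈ F.AI then .st s none s else .st s' none s'
  | x => x

theorem mweight_zero {Q Act : Type} {D : Set Act} (F : IA Q Act) (M : ErrorModel Act D)
    {q : Q} {σ : Act} {t : Q} (h : F.delta q σ t) (hσ : σ ∈ D) : F.mweight M q σ t = 0 := by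
  have : (0 : ℕ) ∈ {n : ℕ | ∃ a, F.delta q a t ∧ M.M a σ = some n} := ⟨σ, h, M.refl σ hσ⟩
  exact Nat.le_zero.mp (Nat.sInf_le this)

theorem modify_of {Q Act : Type} {D : Set Act} (F : IA Q Act) (M : ErrorModel Act D)
    {q : Q} {σ : Act} {t : Q} (h : F.delta q σ t) (hσ : σ ∈ D) : (F.modify M).delta q σ t :=
  Or.inr ⟨σ, h, by simp [M.refl σ hσ]⟩

theorem of_modify {Q Act : Type} {D : Set Act} (F : IA Q Act) (M : ErrorModel Act D)
    {q : Q} {σ : Act} {t : Q} (h : (F.modify M).delta q σ t) (hσ : σ ∉ D) : F.delta q σ t := by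
  rcases h with h | ⟨a, _, h⟩
  · exact h.2
  · exact absurd (M.dom _ _ h).2 hσ

theorem limAvg_nonneg {S : Type} (ω : S → S → ℤ) (hω : ∀ x y, 0 ≤ ω x y) (ρ : ℕ → S) :
    0 ≤ limAvg ω ρ := by
  unfold limAvg
  rw [Filter.liminf_eq]
  apply Real.sSup_nonneg'
  refine ⟨0, ?_, le_rfl⟩
  refine Filter.Eventually.of_forall fun n => ?_
  refine div_nonneg (Finset.sum_nonneg fun i _ => ?_) (Nat.cast_nonneg n)
  exact_mod_cast hω _ _

theorem gameWeight_nonneg {Q Q' Act : Type} (X : IA Q Act)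
    (wX : Q → Act → Q → ℕ) (wY : Q' → Act → Q' → ℕ) (W : ℕ) (x y : GS Q Q' Act) :
    0 ≤ gameWeight X wX wY W x y := by
  unfold gameWeight
  split
  · positivity
  · positivity
  · split <;> positivity
  · exact le_rfl

theorem copy_step {Q Act : Type} (F : IA Q Act) (hF : F.IsBIA)
    (MO : ErrorModel Act F.AO) (MI : ErrorModel Act F.AI) (x : GS Q Q Act)
    (hx : CopyInv F x) (h2 : x.isP2) :
    (simGame (F.modify MO) (F.modify MI)).E x (copyTarget F x) ∧ CopyInv F (copyTarget F x) ∧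
    gameWeight (F.modify MO) (F.mweight MO) (F.mweight MI) (maxW MO MI) x (copyTarget F x) = 0 := by
  rcases hx with ⟨q, rfl⟩ | ⟨q, σ, t, rfl, hσ, hd⟩ | ⟨q, σ, t, rfl, hσ, hd⟩
  · exact absurd h2 (by simp [GS.isP2])
  · have e : copyTarget F (.st t (some σ) q) = .st t none t := by simp [copyTarget, hσ]
    rw [e]
    refine ⟨Or.inl (Or.inl ⟨hσ, modify_of F MI hd hσ, rfl⟩), Or.inl ⟨t, rfl⟩, ?_⟩
    have h' : σ ∈ (F.modify MO).AI := hσ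
    simp [gameWeight, h', mweight_zero F MI hd hσ]
  · have hn : σ ∉ F.AI := fun h => Set.disjoint_left.mp hF.disj h hσ
    have e : copyTarget F (.st q (some σ) t) = .st t none t := by simp [copyTarget, hn]
    rw [e]
    refine ⟨Or.inl (Or.inr ⟨hσ, modify_of F MO hd hσ, rfl⟩), Or.inl ⟨t, rfl⟩, ?_⟩
    have h' : σ ∉ (F.modify MO).AI := hn
    simp [gameWeight, h', mweight_zero F MO hd hσ]

theorem p1_step {Q Act : Type} (F : IA Q Act) (hF : F.IsBIA)
    (MO : ErrorModel Act F.AO) (MI : ErrorModel Act F.AI) (x y : GS Q Q Act)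
    (hx : CopyInv F x) (h2 : ¬ x.isP2)
    (hE : (simGame (F.modify MO) (F.modify MI)).E x y) :
    CopyInv F y ∧
    gameWeight (F.modify MO) (F.mweight MO) (F.mweight MI) (maxW MO MI) x y = 0 := by
  rcases hx with ⟨q, rfl⟩ | ⟨q, σ, t, rfl, hσ, hd⟩ | ⟨q, σ, t, rfl, hσ, hd⟩
  · rcases hE with hE | ⟨h, _⟩ | ⟨_, _, rfl⟩
    · rcases y with _ | ⟨t, _ | σ, t'⟩
      · exact hE.elim
      · exact hE.elim
      · refine ⟨?_, by simp [gameWeight]⟩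
        rcases hE with ⟨hσ, hd, rfl⟩ | ⟨hσ, hd, rfl⟩
        · exact Or.inr (Or.inl ⟨_, _, _, rfl, hσ,
            of_modify F MO hd fun h => Set.disjoint_left.mp hF.disj hσ h⟩)
        · exact Or.inr (Or.inr ⟨_, _, _, rfl, hσ,
            of_modify F MI hd fun h => Set.disjoint_left.mp hF.disj h hσ⟩)
    · exact absurd h h2
    · exact ⟨Or.inl ⟨q, rfl⟩, by simp [gameWeight]⟩
  · exact absurd trivial h2
  · exact absurd trivial h2

/-- A strategy that plays `g` whenever possible. -/
noncomputable def stratOf {S : Type} (H : GameGraph S) (P : Set S) (g : S → S) : Strat H P where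
  f := fun _ s => if H.E s (g s) then g s else (H.serial s).choose
  valid := fun _ s _ => by
    split
    · assumption
    · exact (H.serial s).choose_spec

/-- Reflexivity of the interface simulation distance for the limit-average
objective: for every BIA `F`, output error model `MO` and input error model `MI`,
`d^{LimAvg}(F⊗MO, F⊗MI) = 0`. -/
theorem distLimAvg_refl {Q Act : Type} [Finite Q] [Finite Act]
    (F : IA Q Act) (hF : F.IsBIA)
    (MO : ErrorModel Act F.AO) (MI : ErrorModel Act F.AI) :
    distLimAvg F MO F MI = 0 := by
  have hpos := gameWeight_nonneg (F.modify MO) (F.mweight MO) (F.mweight MI) (maxW MO MI)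
  unfold distLimAvg GameGraph.supInf
  apply le_antisymm
  · set H := simGame (F.modify MO) (F.modify MI) with hH
    refine iSup_le fun π1 => iInf_le_of_le (stratOf _ _ (copyTarget F)) ?_
    set π2 : Strat H H.S2 := stratOf _ _ (copyTarget F) with hπ2
    have step : ∀ n, CopyInv F (H.outcome π1 π2 n) →
        CopyInv F (H.outcome π1 π2 (n + 1)) ∧
        gameWeight (F.modify MO) (F.mweight MO) (F.mweight MI) (maxW MO MI)
          (H.outcome π1 π2 n) (H.outcome π1 π2 (n + 1)) = 0 := by
      intro n hn
      by_cases h2 : (H.outcome π1 π2 n).isP2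
      · have hc := copy_step F hF MO MI _ hn h2
        have e : H.outcome π1 π2 (n + 1) = copyTarget F (H.outcome π1 π2 n) := by
          have h1 : (H.hist π1 π2 n).2 ∉ H.S1 := fun h => h h2
          show (if (H.hist π1 π2 n).2 ∈ H.S1 then _ else _) = _
          rw [if_neg h1]
          exact if_pos hc.1
        rw [e]
        exact hc.2
      · have h1 : (H.hist π1 π2 n).2 ∈ H.S1 := h2
        have e : H.outcome π1 π2 (n + 1) = π1.f (H.hist π1 π2 n).1 (H.hist π1 π2 n).2 := by
          show (if (H.hist π1 π2 n).2 ∈ H.S1 then _ else _) = _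
          rw [if_pos h1]
        rw [e]
        exact p1_step F hF MO MI _ _ hn h2 (π1.valid _ _ h1)
    have inv : ∀ n, CopyInv F (H.outcome π1 π2 n) := by
      intro n
      induction n with
      | zero => exact Or.inl ⟨F.init, rfl⟩
      | succ k ih => exact (step k ih).1
    have hz : limAvg (gameWeight (F.modify MO) (F.mweight MO) (F.mweight MI) (maxW MO MI))
        (H.outcome π1 π2) = 0 := by
      unfold limAvg
      simp [fun n => (step n (inv n)).2]
    rw [hz]
    exact le_rfl
  · refine le_iSup_of_le (stratOf _ _ id) (le_iInf fun π2 => ?_)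
    exact_mod_cast limAvg_nonneg _ hpos _
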